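/- For every g ≥ 3, the group homomorphism φ : π_g → π_{g−1} determined by aᵢ ↦ aᵢ for 1 ≤ i ≤ g−1 and a_g ↦ 1 induces an isomorphism H₂(π_g; ℤ₂) → H₂(π_{g−1}; ℤ₂) on second group homology with trivial ℤ₂-coefficients. -/

import Mathlib

set_option maxSynthPendingDepth 5

/-- Relators of the non-orientable surface group of genus `g`:
the single relator `a₁²a₂²⋯a_g²`. -/
def surfRels (g : ℕ) : Set (FreeGroup (Fin g)) :=
  {(List.ofFn fun i : Fin g => FreeGroup.of i ^ 2).prod}

/-- The fundamental group `π_g = ⟨a₁,…,a_g ∣ a₁²⋯a_g² = 1⟩` of the closed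
non-orientable surface of genus `g`. -/
abbrev SG (g : ℕ) := PresentedGroup (surfRels g)

/-- The differential of the inhomogeneous (bar) chain complex of `π` with trivial
`ℤ₂`-coefficients, from `(n+1)`-chains to `n`-chains. -/
noncomputable def barD (π : Type) [Group π] (n : ℕ) :
    ((Fin (n + 1) → π) →₀ ZMod 2) →ₗ[ZMod 2] ((Fin n → π) →₀ ZMod 2) :=
  Finsupp.lsum (ZMod 2) fun g =>
    LinearMap.toSpanSingleton (ZMod 2) _
      (Finsupp.single (fun j => g j.succ) 1
        + ∑ i : Fin n, Finsupp.single (Fin.contractNth (Fin.castSucc i) (· * ·) g) 1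
        + Finsupp.single (fun j => g (Fin.castSucc j)) 1)

/-- Second group homology with trivial `ℤ₂`-coefficients (2-cycles modulo 2-boundaries). -/
noncomputable abbrev barH2 (π : Type) [Group π] :=
  LinearMap.ker (barD π 1) ⧸
    (Submodule.comap (LinearMap.ker (barD π 1)).subtype (LinearMap.range (barD π 2)))

/-- The extension of `G` by `ℤ₂` determined by a `ℤ₂`-valued function `α` on pairs: the set
`G × ℤ₂`, with multiplication twisted by `α`. -/
@[ext]
structure TwistedProduct (G : Type) (α : G → G → ZMod 2) where
  /-- The component in the quotient group. -/
  base : G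
  /-- The component in the kernel. -/
  fiber : ZMod 2

/-- The inhomogeneous 2-cocycle condition with trivial `ℤ₂`-coefficients. -/
def IsTwoCocycle {G : Type} [Group G] (α : G → G → ZMod 2) : Prop :=
  ∀ a b c, α b c + α (a * b) c + α a (b * c) + α a b = 0

namespace TwistedProduct

variable {G : Type} [Group G] {α : G → G → ZMod 2}

instance : Mul (TwistedProduct G α) :=
  ⟨fun u v => ⟨u.base * v.base, u.fiber + v.fiber + α u.base v.base⟩⟩

instance : One (TwistedProduct G α) := ⟨⟨1, α 1 1⟩⟩

instance : Inv (TwistedProduct G α) :=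
  ⟨fun u => ⟨u.base⁻¹, u.fiber + α u.base⁻¹ u.base + α 1 1⟩⟩

@[simp] lemma base_mul (u v : TwistedProduct G α) : (u * v).base = u.base * v.base := rfl

@[simp] lemma fiber_mul (u v : TwistedProduct G α) :
    (u * v).fiber = u.fiber + v.fiber + α u.base v.base := rfl

@[simp] lemma base_one : (1 : TwistedProduct G α).base = 1 := rfl

@[simp] lemma fiber_one : (1 : TwistedProduct G α).fiber = α 1 1 := rfl

@[simp] lemma base_inv (u : TwistedProduct G α) : u⁻¹.base = u.base⁻¹ := rfl

@[simp] lemma fiber_inv (u : TwistedProduct G α) :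
    u⁻¹.fiber = u.fiber + α u.base⁻¹ u.base + α 1 1 := rfl

/-- The group structure on the twisted product by a 2-cocycle. -/
abbrev group (hα : IsTwoCocycle α) : Group (TwistedProduct G α) :=
  Group.ofLeftAxioms
    (fun u v w => by
      ext
      · simp [mul_assoc]
      · have h := hα u.base v.base w.base
        simp only [fiber_mul, base_mul]
        grind)
    (fun u => by
      ext
      · simp
      · have h := hα 1 1 u.base
        simp only [one_mul] at h
        simp only [fiber_mul, fiber_one, base_one]
        grind)
    (fun u => by
      ext
      · simp
      · simp only [fiber_mul, fiber_inv, base_inv, fiber_one]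
        grind)

end TwistedProduct

lemma barChain_hom_ext {G : Type} {n : ℕ} {M : Type*} [AddCommGroup M] [Module (ZMod 2) M]
    {p q : ((Fin n → G) →₀ ZMod 2) →ₗ[ZMod 2] M}
    (h : ∀ t, p (Finsupp.single t 1) = q (Finsupp.single t 1)) : p = q :=
  Finsupp.lhom_ext' fun t => LinearMap.ext_ring (h t)

section BarComplex

variable {G : Type} [Group G]

lemma barD_one_single (a b : G) :
    barD G 1 (Finsupp.single ![a, b] 1) =
      Finsupp.single ![b] 1 + Finsupp.single ![a * b] 1 + Finsupp.single ![a] 1 := by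
  have h₁ : (fun j : Fin 1 => ![a, b] j.succ) = ![b] := by ext j; fin_cases j; rfl
  have h₂ : Fin.contractNth (Fin.castSucc (0 : Fin 1)) (· * ·) ![a, b] = ![a * b] := by
    ext j; fin_cases j; rfl
  have h₃ : (fun j : Fin 1 => ![a, b] j.castSucc) = ![a] := by ext j; fin_cases j; rfl
  simp only [barD, Finsupp.lsum_single, LinearMap.toSpanSingleton_apply, one_smul, h₁, h₃,
    Fin.sum_univ_one, h₂]

lemma barD_two_single (a b c : G) :
    barD G 2 (Finsupp.single ![a, b, c] 1) =
      Finsupp.single ![b, c] 1 + (Finsupp.single ![a * b, c] 1 + Finsupp.single ![a, b * c] 1)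
        + Finsupp.single ![a, b] 1 := by
  have h₁ : (fun j : Fin 2 => ![a, b, c] j.succ) = ![b, c] := by ext j; fin_cases j <;> rfl
  have h₂ : Fin.contractNth (Fin.castSucc (0 : Fin 2)) (· * ·) ![a, b, c] = ![a * b, c] := by
    ext j; fin_cases j <;> rfl
  have h₃ : Fin.contractNth (Fin.castSucc (1 : Fin 2)) (· * ·) ![a, b, c] = ![a, b * c] := by
    ext j; fin_cases j <;> rfl
  have h₄ : (fun j : Fin 2 => ![a, b, c] j.castSucc) = ![a, b] := by ext j; fin_cases j <;> rfl
  simp only [barD, Finsupp.lsum_single, LinearMap.toSpanSingleton_apply, one_smul, h₁, h₄,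
    Fin.sum_univ_two, h₂, h₃]

/-- A linear functional on 2-chains vanishing on boundaries is a 2-cocycle. -/
lemma isTwoCocycle_of_range_le_ker {l : ((Fin 2 → G) →₀ ZMod 2) →ₗ[ZMod 2] ZMod 2}
    (hl : LinearMap.range (barD G 2) ≤ LinearMap.ker l) :
    IsTwoCocycle fun a b => l (Finsupp.single ![a, b] 1) := by
  intro a b c
  have h : l (barD G 2 (Finsupp.single ![a, b, c] 1)) = 0 := hl ⟨_, rfl⟩
  simp only [barD_two_single, map_add] at h
  rw [← h]
  ring

/-- The 2-chain obtained by reading the word `a₁a₁a₂a₂⋯aₙaₙ` letter by letter, starting at `p`. -/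
noncomputable def squaresChain (p : G) : List G → ((Fin 2 → G) →₀ ZMod 2)
  | [] => 0
  | a :: t => Finsupp.single ![p, a] 1 + Finsupp.single ![p * a, a] 1
      + squaresChain (p * a * a) t

lemma barD_squaresChain (p : G) (t : List G) :
    barD G 1 (squaresChain p t) =
      Finsupp.single ![p] 1 + Finsupp.single ![p * (t.map (· ^ 2)).prod] 1 := by
  induction t generalizing p with
  | nil => simp [squaresChain, CharTwo.add_self_eq_zero, ← Finsupp.single_add]
  | cons a t ih =>
    have h (x : Fin 1 → G) : Finsupp.single x (1 : ZMod 2) + Finsupp.single x 1 = 0 := by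
      rw [← Finsupp.single_add, CharTwo.add_self_eq_zero, Finsupp.single_zero]
    simp only [squaresChain, map_add, barD_one_single, ih, List.map_cons, List.prod_cons,
      pow_two, mul_assoc]
    linear_combination (norm := module) (1 : ZMod 2) • h ![a] + (1 : ZMod 2) • h ![p * a]
      + (1 : ZMod 2) • h ![p * (a * a)]

lemma squaresChain_mem_ker {t : List G} (ht : (t.map (· ^ 2)).prod = 1) :
    squaresChain 1 t ∈ LinearMap.ker (barD G 1) := by
  rw [LinearMap.mem_ker, barD_squaresChain, ht, mul_one, ← Finsupp.single_add,
    CharTwo.add_self_eq_zero, Finsupp.single_zero]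

/-- Multiplying out squares of lifts in the twisted product evaluates the cocycle on
`squaresChain`. -/
lemma TwistedProduct.mul_prod_squares (l : ((Fin 2 → G) →₀ ZMod 2) →ₗ[ZMod 2] ZMod 2)
    (hl : IsTwoCocycle fun a b => l (Finsupp.single ![a, b] 1)) (t : List G) :
    letI := TwistedProduct.group hl
    ∀ u : TwistedProduct G fun a b => l (Finsupp.single ![a, b] 1),
    u * (t.map fun a =>
        (⟨a, 0⟩ : TwistedProduct G fun a b => l (Finsupp.single ![a, b] 1)) ^ 2).prod
      = ⟨u.base * (t.map (· ^ 2)).prod, u.fiber + l (squaresChain u.base t)⟩ := by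
  let := TwistedProduct.group hl
  induction t with
  | nil =>
    intro u
    simp [squaresChain]
  | cons a t ih =>
    intro u
    rw [List.map_cons, List.prod_cons, ← mul_assoc, ih, pow_two, ← mul_assoc]
    ext
    · simp only [base_mul, List.map_cons, List.prod_cons, pow_two, mul_assoc]
    · simp only [base_mul, fiber_mul, squaresChain, map_add]
      ring

end BarComplex

/-- The fundamental 2-cycle of the non-orientable surface group. -/
noncomputable def fundamentalChain (g : ℕ) : (Fin 2 → SG g) →₀ ZMod 2 :=
  squaresChain 1 (List.ofFn fun i => PresentedGroup.of i)

lemma prod_squares_of_eq_one (g : ℕ) :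
    ((List.ofFn fun i : Fin g => (PresentedGroup.of i : SG g)).map (· ^ 2)).prod = 1 := by
  have h :
      PresentedGroup.mk (surfRels g) (List.ofFn fun i : Fin g => FreeGroup.of i ^ 2).prod = 1 :=
    PresentedGroup.one_of_mem rfl
  rw [map_list_prod, List.map_ofFn] at h
  rw [List.map_ofFn]
  exact h

lemma fundamentalChain_mem_ker (g : ℕ) :
    fundamentalChain g ∈ LinearMap.ker (barD (SG g) 1) :=
  squaresChain_mem_ker (prod_squares_of_eq_one g)

/-- A 2-cocycle on the surface group which vanishes on the fundamental cycle is a coboundary. -/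
lemma exists_coboundary_of_fundamentalChain {g : ℕ}
    {l : ((Fin 2 → SG g) →₀ ZMod 2) →ₗ[ZMod 2] ZMod 2}
    (hB : LinearMap.range (barD (SG g) 2) ≤ LinearMap.ker l) (hc : l (fundamentalChain g) = 0) :
    ∃ β : SG g → ZMod 2, ∀ a b, l (Finsupp.single ![a, b] 1) = β b + β (a * b) + β a := by
  have hl := isTwoCocycle_of_range_le_ker hB
  let := TwistedProduct.group hl
  let E := TwistedProduct (SG g) fun a b => l (Finsupp.single ![a, b] 1)
  have hrel : ∀ r ∈ surfRels g,
      FreeGroup.lift (fun i : Fin g => (⟨PresentedGroup.of i, 0⟩ : E)) r = 1 := by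
    rintro r rfl
    have h := TwistedProduct.mul_prod_squares l hl
      (List.ofFn fun i : Fin g => (PresentedGroup.of i : SG g)) 1
    rw [one_mul, prod_squares_of_eq_one, List.map_ofFn] at h
    rw [map_list_prod, List.map_ofFn]
    simp only [Function.comp_def, map_pow, FreeGroup.lift_apply_of] at h ⊢
    rw [h]
    ext
    · simp
    · exact (congrArg _ hc).trans (add_zero _)
  let s : SG g →* E := PresentedGroup.toGroup hrel
  let pr : E →* SG g := ⟨⟨TwistedProduct.base, rfl⟩, fun _ _ => rfl⟩
  have hs : pr.comp s = MonoidHom.id _ := by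
    ext i
    simp [s, pr]
  have hbase (a : SG g) : (s a).base = a := DFunLike.congr_fun hs a
  refine ⟨fun a => (s a).fiber, fun a b => ?_⟩
  have h := congrArg TwistedProduct.fiber (map_mul s a b)
  rw [TwistedProduct.fiber_mul, hbase, hbase] at h
  grind

/-- The second homology of the surface group is spanned by the fundamental class. -/
lemma mem_range_sup_span_fundamentalChain {g : ℕ} {z : (Fin 2 → SG g) →₀ ZMod 2}
    (hz : z ∈ LinearMap.ker (barD (SG g) 1)) :
    z ∈ LinearMap.range (barD (SG g) 2) ⊔ Submodule.span (ZMod 2) {fundamentalChain g} := by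
  by_contra hmem
  obtain ⟨l, hlz, hl⟩ := Submodule.exists_le_ker_of_notMem hmem
  have hc : l (fundamentalChain g) = 0 :=
    hl (Submodule.mem_sup_right (Submodule.mem_span_singleton_self _))
  obtain ⟨β, hβ⟩ := exists_coboundary_of_fundamentalChain (le_sup_left.trans hl) hc
  have hcomp : l = (Finsupp.lsum (ZMod 2) fun t : Fin 1 → SG g =>
      LinearMap.toSpanSingleton (ZMod 2) (ZMod 2) (β (t 0))) ∘ₗ barD (SG g) 1 := by
    refine barChain_hom_ext fun t => ?_
    obtain ⟨a, b, rfl⟩ : ∃ a b, t = ![a, b] := ⟨t 0, t 1, by ext j; fin_cases j <;> rfl⟩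
    rw [LinearMap.comp_apply, barD_one_single, hβ, map_add, map_add]
    simp
  apply hlz
  rw [hcomp, LinearMap.comp_apply, LinearMap.mem_ker.mp hz, map_zero]

lemma barH2_eq_zero_or_eq_fundamental {g : ℕ} (y : barH2 (SG g)) :
    y = 0 ∨ y = Submodule.Quotient.mk ⟨fundamentalChain g, fundamentalChain_mem_ker g⟩ := by
  obtain ⟨⟨z, hz⟩, rfl⟩ := Submodule.Quotient.mk_surjective _ y
  obtain ⟨b, hb, w, hw, rfl⟩ := Submodule.mem_sup.mp (mem_range_sup_span_fundamentalChain hz)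
  obtain ⟨k, rfl⟩ := Submodule.mem_span_singleton.mp hw
  obtain rfl | rfl : k = 0 ∨ k = 1 := by
    have hk : ∀ k : ZMod 2, k = 0 ∨ k = 1 := by decide
    exact hk k
  · left
    rw [Submodule.Quotient.mk_eq_zero]
    simpa using hb
  · right
    rw [Submodule.Quotient.eq]
    simpa using hb

/-- Evaluation of the cup square of a homomorphism `x : G → ℤ₂` on 2-chains. -/
noncomputable def cupSquare {G : Type} [Group G] (x : G →* Multiplicative (ZMod 2)) :
    ((Fin 2 → G) →₀ ZMod 2) →ₗ[ZMod 2] ZMod 2 :=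
  Finsupp.lsum (ZMod 2) fun t =>
    LinearMap.toSpanSingleton (ZMod 2) _ ((x (t 0)).toAdd * (x (t 1)).toAdd)

section CupSquare

variable {G : Type} [Group G] (x : G →* Multiplicative (ZMod 2))

lemma cupSquare_single (a b : G) :
    cupSquare x (Finsupp.single ![a, b] 1) = (x a).toAdd * (x b).toAdd := by
  simp [cupSquare]

lemma cupSquare_comp_barD : cupSquare x ∘ₗ barD G 2 = 0 := by
  refine barChain_hom_ext fun t => ?_
  obtain ⟨a, b, c, rfl⟩ : ∃ a b c, t = ![a, b, c] :=
    ⟨t 0, t 1, t 2, by ext j; fin_cases j <;> rfl⟩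
  simp only [LinearMap.comp_apply, barD_two_single, map_add, cupSquare_single, map_mul,
    toAdd_mul, LinearMap.zero_apply]
  grind

lemma cupSquare_mapDomain {H : Type} [Group H] (φ : H →* G) (c : (Fin 2 → H) →₀ ZMod 2) :
    cupSquare x (Finsupp.mapDomain (fun t => φ ∘ t) c) = cupSquare (x.comp φ) c := by
  have h : cupSquare x ∘ₗ Finsupp.lmapDomain (ZMod 2) (ZMod 2) (fun t : Fin 2 → H => φ ∘ t)
      = cupSquare (x.comp φ) :=
    barChain_hom_ext fun t => by simp [cupSquare]
  exact DFunLike.congr_fun h c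

lemma cupSquare_squaresChain_eq_zero (p : G) {t : List G} (ht : ∀ a ∈ t, x a = 1) :
    cupSquare x (squaresChain p t) = 0 := by
  induction t generalizing p with
  | nil => simp [squaresChain]
  | cons a t ih =>
    simp only [List.forall_mem_cons] at ht
    simp [squaresChain, cupSquare_single, ht.1, ih _ ht.2]

end CupSquare

/-- The cup square of a class dual to the first generator is `1` on the fundamental cycle. -/
lemma cupSquare_fundamentalChain {n : ℕ} (x : SG (n + 1) →* Multiplicative (ZMod 2))
    (h₀ : x (PresentedGroup.of 0) = Multiplicative.ofAdd 1)
    (h : ∀ i : Fin n, x (PresentedGroup.of i.succ) = 1) :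
    cupSquare x (fundamentalChain (n + 1)) = 1 := by
  have ht : cupSquare x (squaresChain (1 * PresentedGroup.of 0 * PresentedGroup.of 0)
      (List.ofFn fun i : Fin n => PresentedGroup.of i.succ)) = 0 :=
    cupSquare_squaresChain_eq_zero x _ (by simpa [List.forall_mem_ofFn_iff] using h)
  rw [fundamentalChain, List.ofFn_succ, squaresChain, map_add, ht]
  simp [cupSquare_single, h₀]

/-- The homomorphism to `ℤ₂` dual to the first generator. -/
lemma exists_dual_first_generator (n : ℕ) :
    ∃ x : SG (n + 1) →* Multiplicative (ZMod 2),
      x (PresentedGroup.of 0) = Multiplicative.ofAdd 1 ∧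
      ∀ i : Fin n, x (PresentedGroup.of i.succ) = 1 := by
  have hrel : ∀ r ∈ surfRels (n + 1), FreeGroup.lift (fun i : Fin (n + 1) =>
      if i = 0 then Multiplicative.ofAdd (1 : ZMod 2) else 1) r = 1 := by
    rintro r rfl
    have hsq : ∀ u : Multiplicative (ZMod 2), u ^ 2 = 1 := by decide
    rw [map_list_prod, List.map_ofFn]
    simp only [Function.comp_def, map_pow, hsq]
    simp
  exact ⟨PresentedGroup.toGroup hrel, by simp, fun i => by simp [Fin.succ_ne_zero]⟩

lemma mapDomain_mem_ker {G H : Type} [Group G] [Group H] (φ : H →* G)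
    {c : (Fin 2 → H) →₀ ZMod 2} (hc : c ∈ LinearMap.ker (barD H 1)) :
    Finsupp.mapDomain (fun t => φ ∘ t) c ∈ LinearMap.ker (barD G 1) := by
  have h : barD G 1 ∘ₗ Finsupp.lmapDomain (ZMod 2) (ZMod 2) (fun t : Fin 2 → H => φ ∘ t) =
      Finsupp.lmapDomain (ZMod 2) (ZMod 2) (fun t : Fin 1 → H => φ ∘ t) ∘ₗ barD H 1 := by
    refine barChain_hom_ext fun t => ?_
    obtain ⟨a, b, rfl⟩ : ∃ a b, t = ![a, b] := ⟨t 0, t 1, by ext j; fin_cases j <;> rfl⟩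
    have h₂ : φ ∘ ![a, b] = ![φ a, φ b] := by ext j; fin_cases j <;> rfl
    have h₁ (d : H) : φ ∘ ![d] = ![φ d] := by ext j; fin_cases j; rfl
    simp only [LinearMap.comp_apply, Finsupp.lmapDomain_apply, Finsupp.mapDomain_single, h₂,
      barD_one_single, map_add, h₁, map_mul]
  have hbd := DFunLike.congr_fun h c
  rw [LinearMap.comp_apply, LinearMap.comp_apply, LinearMap.mem_ker.mp hc, map_zero] at hbd
  exact hbd

/-- For every `g ≥ 3`, the homomorphism `φ : π_g → π_{g-1}` with `φ(aᵢ) = aᵢ` for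
`i ≤ g-1` and `φ(a_g) = 1` induces an isomorphism `H₂(π_g;ℤ₂) → H₂(π_{g-1};ℤ₂)`:
any linear map between the homology groups which is compatible on chain level with
`φ` (i.e. is the induced map) is bijective. -/
theorem stmt14 (g : ℕ) (hg : 3 ≤ g) (φ : SG g →* SG (g - 1))
    (hφ : ∀ i : Fin g, φ (PresentedGroup.of i) =
      if h : (i : ℕ) < g - 1 then PresentedGroup.of ⟨(i : ℕ), h⟩ else 1)
    (f : barH2 (SG g) →ₗ[ZMod 2] barH2 (SG (g - 1)))
    (hf : ∀ (c : (Fin 2 → SG g) →₀ ZMod 2) (hc : c ∈ LinearMap.ker (barD (SG g) 1))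
      (hc' : Finsupp.mapDomain (fun t => φ ∘ t) c ∈ LinearMap.ker (barD (SG (g - 1)) 1)),
      f (Submodule.Quotient.mk ⟨c, hc⟩)
        = Submodule.Quotient.mk ⟨Finsupp.mapDomain (fun t => φ ∘ t) c, hc'⟩) :
    Function.Bijective f := by
  obtain ⟨n, rfl⟩ : ∃ n, g = n + 3 := ⟨g - 3, by omega⟩
  change SG (n + 3) →* SG (n + 2) at φ
  obtain ⟨x, hx₀, hx⟩ := exists_dual_first_generator (n + 1)
  have hev : cupSquare (x.comp φ) (fundamentalChain (n + 3)) = 1 := by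
    refine cupSquare_fundamentalChain _ ?_ fun i => ?_
    · have h : φ (PresentedGroup.of 0) = PresentedGroup.of 0 := (hφ 0).trans (dif_pos (by simp))
      rw [MonoidHom.comp_apply, h, hx₀]
    · rw [MonoidHom.comp_apply]
      by_cases hi : (i : ℕ) < n + 1
      · have h : φ (PresentedGroup.of i.succ) = PresentedGroup.of (Fin.succ ⟨i, hi⟩) :=
          (hφ i.succ).trans (dif_pos (by simpa using hi))
        rw [h, hx]
      · have h : φ (PresentedGroup.of i.succ) = 1 :=
          (hφ i.succ).trans (dif_neg (by simpa using hi))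
        rw [h, map_one]
  have hc := fundamentalChain_mem_ker (n + 3)
  have hne : f (Submodule.Quotient.mk ⟨fundamentalChain (n + 3), hc⟩) ≠ 0 := by
    rw [hf _ hc (mapDomain_mem_ker φ hc), Ne, Submodule.Quotient.mk_eq_zero]
    rintro ⟨w, hw⟩
    have h : cupSquare x (Finsupp.mapDomain (fun t => φ ∘ t) (fundamentalChain (n + 3))) = 0 :=
      (congrArg (cupSquare x) hw).symm.trans (DFunLike.congr_fun (cupSquare_comp_barD x) w)
    rw [cupSquare_mapDomain, hev] at h
    exact one_ne_zero h
  constructor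
  · rw [injective_iff_map_eq_zero]
    intro y hy
    obtain rfl | rfl := barH2_eq_zero_or_eq_fundamental y
    · rfl
    · exact absurd hy hne
  · intro y
    obtain rfl | rfl := barH2_eq_zero_or_eq_fundamental y
    · exact ⟨0, map_zero f⟩
    · exact ⟨_, (barH2_eq_zero_or_eq_fundamental _).resolve_left hne⟩
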